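/- Suppose the dealer is a member of the Vamos pair A (e.g., the dealer is v1, so the access structure is V1 = Γ_{v1}). Then for any perfect secret sharing scheme, 2/19 ≤ λ. -/

import Mathlib

open MeasureTheory Finset

/-- Shannon entropy of a random variable with values in a finite type:
`H(f) = ∑ₐ −P(f = a)·log P(f = a)`. -/
noncomputable def shannonEntropy {Ω : Type} [MeasurableSpace Ω] {α : Type} [Fintype α]
    (μ : Measure Ω) (f : Ω → α) : ℝ :=
  ∑ a : α, Real.negMulLog ((μ (f ⁻¹' {a})).toReal)

/-- A family of random variables on a common probability space: one (finite-valued)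
random variable `secret` for the secret, and one random variable `share p` for the
share of each participant `p`. -/
structure Scheme (P : Type) [Fintype P] [DecidableEq P] where
  (Ω : Type)
  [mΩ : MeasurableSpace Ω]
  (μ : Measure Ω)
  [prob : IsProbabilityMeasure μ]
  (SecT : Type)
  [secFin : Fintype SecT]
  (ShT : P → Type)
  [shFin : ∀ p, Fintype (ShT p)]
  (secret : Ω → SecT)
  (share : (p : P) → Ω → ShT p)
  (secret_meas : ∀ s : Set SecT, MeasurableSet (secret ⁻¹' s))
  (share_meas : ∀ p, ∀ s : Set (ShT p), MeasurableSet (share p ⁻¹' s))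

namespace Scheme

variable {P : Type} [Fintype P] [DecidableEq P]

/-- `H(S)`: the entropy of the secret. -/
noncomputable def Hsec (S : Scheme P) : ℝ :=
  letI := S.mΩ; letI := S.secFin
  shannonEntropy S.μ S.secret

/-- `H(X)`: the joint entropy of the shares of the participants in `X`. -/
noncomputable def Hset (S : Scheme P) (X : Finset P) : ℝ :=
  letI := S.mΩ; letI := S.shFin
  shannonEntropy S.μ (fun ω => fun p : {y // y ∈ X} => S.share p.1 ω)

/-- `H(X ∪ {S})`: the joint entropy of the shares of the participants in `X`
together with the secret. -/
noncomputable def HsetS (S : Scheme P) (X : Finset P) : ℝ :=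
  letI := S.mΩ; letI := S.secFin; letI := S.shFin
  shannonEntropy S.μ (fun ω => ((fun p : {y // y ∈ X} => S.share p.1 ω), S.secret ω))

/-- The normalized entropy `h(X) = H(X)/H(S)`. -/
noncomputable def hset (S : Scheme P) (X : Finset P) : ℝ := S.Hset X / S.Hsec

/-- The conditional normalized entropy `h(X|Y) = h(X ∪ Y) − h(Y)`. -/
noncomputable def hcond (S : Scheme P) (X Y : Finset P) : ℝ :=
  S.hset (X ∪ Y) - S.hset Y

/-- `Σ` is a perfect secret sharing scheme for the access structure `Γ`:
the conditional entropy `H(S|X) = H(X ∪ {S}) − H(X)` equals `0` for every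
qualified set `X` and equals `H(S)` for every unqualified set `X`. -/
def IsPerfect (S : Scheme P) (Γ : Finset P → Prop) : Prop :=
  (∀ X : Finset P, Γ X → S.HsetS X - S.Hset X = 0) ∧
  (∀ X : Finset P, ¬ Γ X → S.HsetS X - S.Hset X = S.Hsec)

end Scheme
/-- The four Vamos pairs `A = {v₁,v₂}`, `B = {v₃,v₄}`, `C = {v₅,v₆}`, `D = {v₇,v₈}`,
where participant `vᵢ` is represented by `(i-1 : Fin 8)`. -/
def pairA : Finset (Fin 8) := {0, 1}
def pairB : Finset (Fin 8) := {2, 3}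
def pairC : Finset (Fin 8) := {4, 5}
def pairD : Finset (Fin 8) := {6, 7}

/-- `X` is one of the four Vamos pairs. -/
def IsVamosPair (X : Finset (Fin 8)) : Prop :=
  X = pairA ∨ X = pairB ∨ X = pairC ∨ X = pairD

/-- The dependent sets of the Vamos matroid: the five special four-element sets
`AB`, `AC`, `BC`, `BD`, `CD`, and all sets with at least five elements. -/
def VamosDep (X : Finset (Fin 8)) : Prop :=
  X = pairA ∪ pairB ∨ X = pairA ∪ pairC ∨ X = pairB ∪ pairC ∨
    X = pairB ∪ pairD ∨ X = pairC ∪ pairD ∨ 5 ≤ X.card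

/-- The circuits of the Vamos matroid: minimal dependent sets. -/
def VamosCircuit (X : Finset (Fin 8)) : Prop :=
  VamosDep X ∧ ∀ Y ⊂ X, ¬ VamosDep Y

/-- The access structure `Γₓ` induced by the Vamos matroid with dealer `x`
(the dealer is regarded as a participant who is individually qualified):
a set is qualified iff it contains a minimal qualified set, the minimal
qualified sets being `{x}` and the sets `M ⊆ Q \ {x}` with `M ∪ {x}` a circuit. -/
def VamosQualified (x : Fin 8) (Y : Finset (Fin 8)) : Prop :=
  x ∈ Y ∨ ∃ M ⊆ Y, x ∉ M ∧ VamosCircuit (insert x M)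

/-- `λ = (max₁≤ᵢ≤₈ h({vᵢ})) − 1`. -/
noncomputable def Scheme.lam (S : Scheme (Fin 8)) : ℝ :=
  (Finset.univ.sup' Finset.univ_nonempty fun i : Fin 8 => S.hset {i}) - 1

/-- The information rate `ρ(Σ) = min₁≤ᵢ≤₈ H(S)/H(vᵢ)` of a scheme. -/
noncomputable def Scheme.rho (S : Scheme (Fin 8)) : ℝ :=
  Finset.univ.inf' Finset.univ_nonempty fun i : Fin 8 => S.Hsec / S.Hset {i}

open Classical in
/-- The total mass that `p` gives to the class of `t` under the setoid `r`. -/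
noncomputable def classMass {T : Type*} [Fintype T] (p : T → ℝ) (r : Setoid T) (t : T) : ℝ :=
  ∑ s, p s * if r t s then 1 else 0

/-- The entropy of the partition of `T` into the classes of the setoid `r`, where the points of `T`
are weighted by `p`. -/
noncomputable def partEntropy {T : Type*} [Fintype T] (p : T → ℝ) (r : Setoid T) : ℝ :=
  -∑ t, p t * Real.log (classMass p r t)

section partEntropy

variable {T : Type*} [Fintype T] {p : T → ℝ}

theorem classMass_congr (p : T → ℝ) (r : Setoid T) {s t : T} (h : r s t) :
    classMass p r s = classMass p r t := by
  classical
  unfold classMass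
  refine Finset.sum_congr rfl fun u _ => ?_
  have : r s u ↔ r t u := ⟨fun h' => r.trans (r.symm h) h', fun h' => r.trans h h'⟩
  simp only [this]

theorem classMass_nonneg (hp : ∀ t, 0 ≤ p t) (r : Setoid T) (t : T) : 0 ≤ classMass p r t :=
  Finset.sum_nonneg fun s _ => mul_nonneg (hp s) (by split_ifs <;> norm_num)

theorem le_classMass (hp : ∀ t, 0 ≤ p t) (r : Setoid T) (t : T) : p t ≤ classMass p r t := by
  classical
  have h := Finset.single_le_sum (f := fun s => p s * if r t s then (1 : ℝ) else 0)
    (fun s _ => mul_nonneg (hp s) (by split_ifs <;> norm_num)) (Finset.mem_univ t)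
  simpa [r.refl t, classMass] using h

theorem classMass_mono (hp : ∀ t, 0 ≤ p t) {r s : Setoid T} (h : r ≤ s) (t : T) :
    classMass p r t ≤ classMass p s t := by
  refine Finset.sum_le_sum fun u _ => mul_le_mul_of_nonneg_left ?_ (hp u)
  by_cases hr : r t u
  · simp [hr, h hr]
  · simp only [hr, if_false]
    split_ifs <;> norm_num

theorem partEntropy_anti (hp : ∀ t, 0 ≤ p t) {r s : Setoid T} (h : r ≤ s) :
    partEntropy p s ≤ partEntropy p r := by
  refine neg_le_neg (Finset.sum_le_sum fun t _ => ?_)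
  rcases (hp t).eq_or_lt with h0 | h0
  · simp [← h0]
  · exact mul_le_mul_of_nonneg_left
      (Real.log_le_log (h0.trans_le (le_classMass hp r t)) (classMass_mono hp h t)) h0.le

theorem partEntropy_top (h1 : ∑ t, p t = 1) : partEntropy p ⊤ = 0 := by
  simp [partEntropy, classMass, Setoid.top_def, h1]

/-- The expectation of the likelihood ratio that occurs in the submodularity of entropy is at
most the total mass. -/
theorem sum_likelihoodRatio_le (hp : ∀ t, 0 ≤ p t) {a b k : Setoid T} (ha : a ≤ k) (hb : b ≤ k) :
    ∑ t, p t * (classMass p a t * classMass p b t / (classMass p (a ⊓ b) t * classMass p k t)) ≤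
      ∑ t, p t := by
  classical
  have inner (s r : T) : ∑ t, p t * ((if a t s then (1 : ℝ) else 0) * (if b t r then 1 else 0) /
      (classMass p (a ⊓ b) t * classMass p k t)) ≤
      (if k s r then 1 else 0) / classMass p k s := by
    by_cases hex : ∃ t, a t s ∧ b t r
    · obtain ⟨t₀, h1, h2⟩ := hex
      have hk : k s r := k.trans (k.symm (ha h1)) (hb h2)
      have hk0 : k t₀ s := ha h1
      rw [if_pos hk]
      have hterm (t : T) : p t * ((if a t s then (1 : ℝ) else 0) * (if b t r then 1 else 0) /
          (classMass p (a ⊓ b) t * classMass p k t)) =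
          (p t * if (a ⊓ b) t₀ t then 1 else 0) *
            (1 / (classMass p (a ⊓ b) t₀ * classMass p k s)) := by
        by_cases h : (a ⊓ b) t₀ t
        · have h' := Setoid.inf_iff_and.1 h
          have e1 : a t s := a.trans (a.symm h'.1) h1
          have e2 : b t r := b.trans (b.symm h'.2) h2
          rw [if_pos e1, if_pos e2, if_pos h, ← classMass_congr p _ h,
            ← classMass_congr p k (k.trans (k.symm hk0) (ha h'.1))]
          ring
        · rw [if_neg h]
          have : ¬ (a t s ∧ b t r) := fun hh => h (Setoid.inf_iff_and.2
            ⟨a.trans h1 (a.symm hh.1), b.trans h2 (b.symm hh.2)⟩)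
          by_cases e1 : a t s
          · have e2 : ¬ b t r := fun e2 => this ⟨e1, e2⟩
            simp [e2]
          · simp [e1]
      rw [Finset.sum_congr rfl fun t _ => hterm t, ← Finset.sum_mul]
      change classMass p (a ⊓ b) t₀ * _ ≤ _
      rcases (classMass_nonneg hp (a ⊓ b) t₀).eq_or_lt with h0 | h0
      · rw [← h0, zero_mul]
        exact div_nonneg zero_le_one (classMass_nonneg hp k s)
      · rw [one_div, mul_inv, ← mul_assoc, mul_inv_cancel₀ h0.ne', one_mul, one_div]
    · rw [Finset.sum_eq_zero]
      · exact div_nonneg (by split_ifs <;> norm_num) (classMass_nonneg hp k s)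
      · intro t _
        by_cases e1 : a t s
        · have e2 : ¬ b t r := fun e2 => hex ⟨t, e1, e2⟩
          simp [e2]
        · simp [e1]
  calc ∑ t, p t * (classMass p a t * classMass p b t / (classMass p (a ⊓ b) t * classMass p k t))
      = ∑ s, ∑ r, p s * p r * ∑ t, p t * ((if a t s then (1 : ℝ) else 0) *
          (if b t r then 1 else 0) / (classMass p (a ⊓ b) t * classMass p k t)) := by
        simp_rw [Finset.mul_sum]
        rw [Finset.sum_congr rfl fun s _ => Finset.sum_comm, Finset.sum_comm]
        refine Finset.sum_congr rfl fun t _ => ?_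
        rw [show classMass p a t * classMass p b t = ∑ s, ∑ r,
          (p s * if a t s then 1 else 0) * (p r * if b t r then 1 else 0) from
            Finset.sum_mul_sum _ _ _ _, Finset.sum_div, Finset.mul_sum]
        refine Finset.sum_congr rfl fun s _ => ?_
        rw [Finset.sum_div, Finset.mul_sum]
        refine Finset.sum_congr rfl fun r _ => ?_
        ring
    _ ≤ ∑ s, ∑ r, p s * p r * ((if k s r then 1 else 0) / classMass p k s) :=
        Finset.sum_le_sum fun s _ => Finset.sum_le_sum fun r _ =>
          mul_le_mul_of_nonneg_left (inner s r) (mul_nonneg (hp s) (hp r))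
    _ = ∑ s, p s * (classMass p k s / classMass p k s) := by
        refine Finset.sum_congr rfl fun s _ => ?_
        rw [show classMass p k s / classMass p k s =
          (∑ r, p r * if k s r then 1 else 0) / classMass p k s from rfl,
          Finset.sum_div, Finset.mul_sum]
        exact Finset.sum_congr rfl fun r _ => by ring
    _ ≤ ∑ s, p s := Finset.sum_le_sum fun s _ =>
        mul_le_of_le_one_right (hp s) (div_self_le_one _)

theorem partEntropy_submodular (hp : ∀ t, 0 ≤ p t) {a b k : Setoid T} (ha : a ≤ k) (hb : b ≤ k) :
    partEntropy p (a ⊓ b) + partEntropy p k ≤ partEntropy p a + partEntropy p b := by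
  have hlog (t : T) : p t * (1 - classMass p a t * classMass p b t /
      (classMass p (a ⊓ b) t * classMass p k t)) ≤
      p t * Real.log (classMass p (a ⊓ b) t) + p t * Real.log (classMass p k t) -
        p t * Real.log (classMass p a t) - p t * Real.log (classMass p b t) := by
    rcases (hp t).eq_or_lt with h0 | h0
    · simp [← h0]
    · have pos (r : Setoid T) : 0 < classMass p r t := h0.trans_le (le_classMass hp r t)
      have h := Real.log_le_sub_one_of_pos (div_pos (mul_pos (pos a) (pos b))
        (mul_pos (pos (a ⊓ b)) (pos k)))
      rw [Real.log_div (mul_pos (pos a) (pos b)).ne' (mul_pos (pos _) (pos k)).ne',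
        Real.log_mul (pos a).ne' (pos b).ne', Real.log_mul (pos _).ne' (pos k).ne'] at h
      have h' := mul_le_mul_of_nonneg_left h h0.le
      linarith
  have hsum := Finset.sum_le_sum fun t (_ : t ∈ Finset.univ) => hlog t
  simp only [mul_sub, mul_one, Finset.sum_sub_distrib, Finset.sum_add_distrib] at hsum
  have := sum_likelihoodRatio_le hp ha hb
  unfold partEntropy
  linarith

/-- Entropy is preserved by maps that push `q` forward to `p`. -/
theorem partEntropy_comap {T' : Type*} [Fintype T'] {q : T' → ℝ} {π : T' → T}
    (h : ∀ F : T → ℝ, ∑ y, q y * F (π y) = ∑ t, p t * F t) (r : Setoid T) :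
    partEntropy q (r.comap π) = partEntropy p r := by
  classical
  have hm (y : T') : classMass q (r.comap π) y = classMass p r (π y) :=
    h fun s => if r (π y) s then 1 else 0
  simp only [partEntropy, hm]
  rw [h fun t => Real.log (classMass p r t)]

end partEntropy

section conditionalCopy

variable {T : Type*} [Fintype T]

/-- Pairs of points of `T` in the same class of `c`. -/
abbrev PairsOver (c : Setoid T) : Type _ := {x : T × T // c x.1 x.2}

/-- The law of two copies of a point of law `p` that are conditionally independent given
their common class under `c`. -/
noncomputable def pairLaw (p : T → ℝ) (c : Setoid T) (x : PairsOver c) : ℝ :=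
  p x.1.1 * p x.1.2 / classMass p c x.1.1

variable {p : T → ℝ} {c : Setoid T}

noncomputable instance : Fintype (PairsOver c) := Fintype.ofFinite _

open Classical in
theorem sum_pairsOver (c : Setoid T) (F : T × T → ℝ) :
    ∑ x : PairsOver c, F x.1 = ∑ s, ∑ t, F (s, t) * if c s t then 1 else 0 := by
  rw [← Fintype.sum_prod_type' (f := fun s t => F (s, t) * if c s t then (1 : ℝ) else 0)]
  simp only [mul_ite, mul_one, mul_zero]
  rw [← Finset.sum_filter]
  exact (Finset.sum_subtype _ (by simp) F).symm

theorem mul_classMass_div_self (hp : ∀ t, 0 ≤ p t) (c : Setoid T) (s : T) :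
    p s * (classMass p c s / classMass p c s) = p s := by
  rcases (hp s).eq_or_lt with h0 | h0
  · simp [← h0]
  · rw [div_self (h0.trans_le (le_classMass hp c s)).ne', mul_one]

theorem sum_pairLaw_fst (hp : ∀ t, 0 ≤ p t) (F : T → ℝ) :
    ∑ x : PairsOver c, pairLaw p c x * F x.1.1 = ∑ t, p t * F t := by
  classical
  refine (sum_pairsOver c fun x => p x.1 * p x.2 / classMass p c x.1 * F x.1).trans ?_
  refine Finset.sum_congr rfl fun s _ => ?_
  conv_rhs => rw [← mul_classMass_div_self hp c s]
  rw [show classMass p c s / classMass p c s =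
    (∑ r, p r * if c s r then 1 else 0) / classMass p c s from rfl,
    Finset.sum_div, Finset.mul_sum, Finset.sum_mul]
  exact Finset.sum_congr rfl fun r _ => by ring

theorem sum_pairLaw_snd (hp : ∀ t, 0 ≤ p t) (F : T → ℝ) :
    ∑ x : PairsOver c, pairLaw p c x * F x.1.2 = ∑ t, p t * F t := by
  rw [← sum_pairLaw_fst (c := c) hp F]
  refine Fintype.sum_equiv
    ((Equiv.prodComm T T).subtypeEquiv fun x => ⟨fun h => c.symm h, fun h => c.symm h⟩) _ _ ?_
  rintro ⟨⟨s, t⟩, h⟩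
  simp only [pairLaw, Equiv.subtypeEquiv_apply, Equiv.prodComm_apply, Prod.swap]
  rw [classMass_congr p c h, mul_comm (p s)]

theorem classMass_pairLaw {a b : Setoid T} (ha : a ≤ c) (hb : b ≤ c) (x : PairsOver c) :
    classMass (pairLaw p c) (a.comap (fun x : PairsOver c => x.1.1) ⊓
      b.comap fun x : PairsOver c => x.1.2) x =
      classMass p a x.1.1 * classMass p b x.1.2 / classMass p c x.1.1 := by
  classical
  obtain ⟨⟨s, t⟩, hst⟩ := x
  have key : classMass (pairLaw p c) (a.comap (fun x : PairsOver c => x.1.1) ⊓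
      b.comap fun x : PairsOver c => x.1.2) ⟨(s, t), hst⟩ =
      ∑ x : PairsOver c, (fun y : T × T => p y.1 * p y.2 / classMass p c y.1 *
        if a s y.1 ∧ b t y.2 then 1 else 0) x.1 := by
    unfold classMass
    refine Finset.sum_congr rfl fun y _ => ?_
    simp only [Setoid.inf_iff_and, Setoid.comap_rel]
    rfl
  rw [key]
  refine (sum_pairsOver c fun y : T × T => p y.1 * p y.2 / classMass p c y.1 *
    if a s y.1 ∧ b t y.2 then 1 else 0).trans ?_
  rw [show classMass p a s * classMass p b t = ∑ s', ∑ t',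
    (p s' * if a s s' then 1 else 0) * (p t' * if b t t' then 1 else 0) from
      Finset.sum_mul_sum _ _ _ _, Finset.sum_div]
  refine Finset.sum_congr rfl fun s' _ => ?_
  rw [Finset.sum_div]
  refine Finset.sum_congr rfl fun t' _ => ?_
  by_cases h1 : a s s'
  · by_cases h2 : b t t'
    · have h3 : c s' t' := c.trans (c.symm (ha h1)) (c.trans hst (hb h2))
      simp [h1, h2, h3, classMass_congr p c (ha h1)]
    · simp [h2]
  · simp [h1]

theorem partEntropy_pairLaw (hp : ∀ t, 0 ≤ p t) {a b : Setoid T} (ha : a ≤ c) (hb : b ≤ c) :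
    partEntropy (pairLaw p c) (a.comap (fun x : PairsOver c => x.1.1) ⊓
      b.comap fun x : PairsOver c => x.1.2) =
      partEntropy p a + partEntropy p b - partEntropy p c := by
  have hlog (x : PairsOver c) : pairLaw p c x * Real.log (classMass (pairLaw p c)
      (a.comap (fun x : PairsOver c => x.1.1) ⊓ b.comap fun x : PairsOver c => x.1.2) x) =
      pairLaw p c x * Real.log (classMass p a x.1.1) +
        pairLaw p c x * Real.log (classMass p b x.1.2) -
        pairLaw p c x * Real.log (classMass p c x.1.1) := by
    rw [classMass_pairLaw ha hb]
    rcases (hp x.1.1).eq_or_lt with h1 | h1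
    · simp [pairLaw, ← h1]
    rcases (hp x.1.2).eq_or_lt with h2 | h2
    · simp [pairLaw, ← h2]
    have pa := h1.trans_le (le_classMass hp a x.1.1)
    have pb := h2.trans_le (le_classMass hp b x.1.2)
    have pc := h1.trans_le (le_classMass hp c x.1.1)
    rw [Real.log_div (mul_pos pa pb).ne' pc.ne', Real.log_mul pa.ne' pb.ne']
    ring
  unfold partEntropy
  rw [Finset.sum_congr rfl fun x _ => hlog x, Finset.sum_sub_distrib, Finset.sum_add_distrib,
    sum_pairLaw_fst hp fun t => Real.log (classMass p a t),
    sum_pairLaw_snd hp fun t => Real.log (classMass p b t),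
    sum_pairLaw_fst hp fun t => Real.log (classMass p c t)]
  ring

theorem pairLaw_nonneg (hp : ∀ t, 0 ≤ p t) (x : PairsOver c) : 0 ≤ pairLaw p c x :=
  div_nonneg (mul_nonneg (hp _) (hp _)) (classMass_nonneg hp _ _)

/-- A Shannon-type inequality from which the Zhang–Yeung inequality follows when `r` is a copy
of `a` that is independent of `a`, `b` given `c`, `d`. -/
theorem partEntropy_five (hp : ∀ t, 0 ≤ p t) (a b c d r : Setoid T) :
    2 * partEntropy p c + 2 * partEntropy p d + partEntropy p r + partEntropy p (a ⊓ b) +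
      partEntropy p (a ⊓ c ⊓ d) + partEntropy p (b ⊓ c ⊓ d) +
      3 * partEntropy p (a ⊓ b ⊓ c ⊓ d ⊓ r) ≤
    3 * partEntropy p (a ⊓ b ⊓ c ⊓ d) + partEntropy p (a ⊓ d) + 2 * partEntropy p (r ⊓ d) +
      partEntropy p (a ⊓ c) + 2 * partEntropy p (r ⊓ c) + partEntropy p (b ⊓ d) +
      partEntropy p (b ⊓ c) := by
  have sub (x y z : Setoid T) : partEntropy p (x ⊓ z ⊓ (y ⊓ z)) + partEntropy p z ≤
      partEntropy p (x ⊓ z) + partEntropy p (y ⊓ z) :=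
    partEntropy_submodular hp inf_le_right inf_le_right
  have h1 := sub c r (a ⊓ b ⊓ d)
  have h2 := sub c d (a ⊓ r)
  have h3 := sub c d (b ⊓ r)
  have h4 := sub a r d
  have h5 := sub a b r
  have h6 := sub d r (a ⊓ b)
  have h7 := sub a r c
  have h8 := sub b r (a ⊓ c ⊓ d)
  have h9 := sub b r d
  have h10 := sub a r (b ⊓ c ⊓ d)
  have h11 := sub b r c
  simp only [inf_comm, inf_left_comm, inf_idem, inf_left_idem]
    at h1 h2 h3 h4 h5 h6 h7 h8 h9 h10 h11 ⊢
  linarith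

/-- The Zhang–Yeung inequality
`2 I(C;D) ≤ I(A;B) + I(A;CD) + 3 I(C;D|A) + I(C;D|B)`. -/
theorem zhang_yeung (hp : ∀ t, 0 ≤ p t) (A B C D : Setoid T) :
    2 * (partEntropy p C + partEntropy p D - partEntropy p (C ⊓ D)) ≤
      (partEntropy p A + partEntropy p B - partEntropy p (A ⊓ B)) +
      (partEntropy p A + partEntropy p (C ⊓ D) - partEntropy p (A ⊓ C ⊓ D)) +
      3 * (partEntropy p (A ⊓ C) + partEntropy p (A ⊓ D) -
        partEntropy p (A ⊓ C ⊓ D) - partEntropy p A) +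
      (partEntropy p (B ⊓ C) + partEntropy p (B ⊓ D) -
        partEntropy p (B ⊓ C ⊓ D) - partEntropy p B) := by
  let q := pairLaw p (C ⊓ D)
  have hq : ∀ x, 0 ≤ q x := pairLaw_nonneg hp
  let φ : PairsOver (C ⊓ D) → T := fun x => x.1.1
  let ψ : PairsOver (C ⊓ D) → T := fun x => x.1.2
  have e₁ (r : Setoid T) : partEntropy q (r.comap φ) = partEntropy p r :=
    partEntropy_comap (sum_pairLaw_fst hp) r
  have e₂ (r : Setoid T) : partEntropy q (r.comap ψ) = partEntropy p r :=
    partEntropy_comap (sum_pairLaw_snd hp) r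
  have comap_inf (π : PairsOver (C ⊓ D) → T) (r s : Setoid T) :
      (r ⊓ s).comap π = r.comap π ⊓ s.comap π := rfl
  have comap_eq (r : Setoid T) (h : C ⊓ D ≤ r) : r.comap ψ = r.comap φ := by
    ext x y
    have hx : r (φ x) (ψ x) := h x.2
    have hy : r (φ y) (ψ y) := h y.2
    exact ⟨fun h' => r.trans hx (r.trans h' (r.symm hy)),
      fun h' => r.trans (r.symm hx) (r.trans h' hy)⟩
  have eC := comap_eq C inf_le_left
  have eD := comap_eq D inf_le_right
  have hind : partEntropy q ((A ⊓ B ⊓ C ⊓ D).comap φ ⊓ (A ⊓ C ⊓ D).comap ψ) =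
      partEntropy p (A ⊓ B ⊓ C ⊓ D) + partEntropy p (A ⊓ C ⊓ D) - partEntropy p (C ⊓ D) :=
    partEntropy_pairLaw hp
      (le_inf (inf_le_left.trans inf_le_right) inf_le_right)
      (le_inf (inf_le_left.trans inf_le_right) inf_le_right)
  have hjoint : (A ⊓ B ⊓ C ⊓ D).comap φ ⊓ (A ⊓ C ⊓ D).comap ψ =
      (A ⊓ B ⊓ C ⊓ D).comap φ ⊓ A.comap ψ := by
    rw [comap_inf ψ, comap_inf ψ, eC, eD, comap_inf φ, comap_inf φ]
    refine le_antisymm (inf_le_inf_left _ (inf_le_left.trans inf_le_left))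
      (le_inf inf_le_left (le_inf (le_inf inf_le_right ?_) ?_))
    · exact inf_le_left.trans (inf_le_left.trans inf_le_right)
    · exact inf_le_left.trans inf_le_right
  rw [hjoint] at hind
  have h := partEntropy_five hq (A.comap φ) (B.comap φ) (C.comap φ) (D.comap φ) (A.comap ψ)
  have hAC : partEntropy q (A.comap ψ ⊓ C.comap φ) = partEntropy p (A ⊓ C) := by
    rw [← eC, ← comap_inf, e₂]
  have hAD : partEntropy q (A.comap ψ ⊓ D.comap φ) = partEntropy p (A ⊓ D) := by
    rw [← eD, ← comap_inf, e₂]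
  simp only [← comap_inf, e₁, e₂, hind, hAC, hAD] at h
  linarith

end conditionalCopy

/-- Some sets of participants that are qualified when the dealer is participant `0`. -/
def qualifiedSets : List (Finset (Fin 8)) :=
  [{1, 2, 3},
   {1, 4, 5},
   {1, 2, 3, 5},
   {1, 2, 3, 6},
   {1, 2, 4, 6},
   {1, 2, 5, 6},
   {1, 2, 6, 7},
   {1, 3, 4, 5},
   {1, 3, 5, 6},
   {1, 3, 6, 7},
   {1, 2, 3, 4, 5},
   {1, 2, 3, 5, 6},
   {1, 2, 3, 6, 7},
   {1, 2, 4, 6, 7},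
   {1, 3, 4, 5, 6},
   {1, 4, 5, 6, 7},
   {2, 3, 4, 6, 7},
   {2, 3, 5, 6, 7},
   {3, 4, 5, 6, 7},
   {1, 2, 3, 5, 6, 7},
   {1, 3, 4, 5, 6, 7}]

/-- Some sets of participants that are not qualified when the dealer is participant `0`. -/
def unqualifiedSets : List (Finset (Fin 8)) :=
  [{1},
   {1, 2, 5},
   {1, 2, 6},
   {1, 3, 5},
   {1, 3, 6},
   {1, 6, 7},
   {2, 3, 4, 5},
   {2, 3, 6, 7},
   {4, 5, 6, 7}]

/-- The bound `9/8` for a polymatroid `f` on the secret `0` and the participants `1, …, 7` that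
satisfies one instance of the Zhang–Yeung inequality. -/
theorem nine_eighths_le_of_polymatroid (f : Finset (Fin 8) → ℝ) (m : ℝ) (empty : f ∅ = 0)
    (mono : ∀ X Y, X ⊆ Y → f X ≤ f Y)
    (sub : ∀ X Y, f (X ∪ Y) + f (X ∩ Y) ≤ f X + f Y)
    (zy : 2 * (f pairB + f pairC - f (pairB ∪ pairC)) ≤
      (f pairA + f pairD - f (pairA ∪ pairD)) +
      (f pairA + f (pairB ∪ pairC) - f (pairA ∪ pairB ∪ pairC)) +
      3 * (f (pairA ∪ pairB) + f (pairA ∪ pairC) - f (pairA ∪ pairB ∪ pairC) - f pairA) +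
      (f (pairD ∪ pairB) + f (pairD ∪ pairC) - f (pairD ∪ pairB ∪ pairC) - f pairD))
    (hq : ∀ X ∈ qualifiedSets, f (insert 0 X) = f X)
    (hu : ∀ X ∈ unqualifiedSets, f (insert 0 X) = f X + 1)
    (hm : ∀ i, i ≠ 0 → f {i} ≤ m) : 9 / 8 ≤ m := by
  have sub0 (X Y Z K : Finset (Fin 8)) (hZ : X ∪ Y = Z) (hK : X ∩ Y = K) :
      f Z + f K ≤ f X + f Y := hZ ▸ hK ▸ sub X Y
  have sub1 (X Y Z K : Finset (Fin 8)) (hZ : X ∪ Y = Z) (hK : X ∩ Y = K)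
      (qX : X ∈ qualifiedSets) (qY : Y ∈ qualifiedSets) (qZ : Z ∈ qualifiedSets)
      (uK : K ∈ unqualifiedSets) : f Z + f K + 1 ≤ f X + f Y := by
    have h := sub (insert 0 X) (insert 0 Y)
    rw [← Finset.insert_union_distrib, ← Finset.insert_inter_distrib, hZ, hK, hq X qX, hq Y qY,
      hq Z qZ, hu K uK] at h
    linarith
  have mono1 (X Y : Finset (Fin 8)) (h : X ⊆ Y) (uX : X ∈ unqualifiedSets)
      (qY : Y ∈ qualifiedSets) : f X + 1 ≤ f Y := by
    rw [← hu X uX, ← hq Y qY]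
    exact mono _ _ (Finset.insert_subset_insert 0 h)
  have i1 := sub0 {2} {1} {1, 2} ∅ (by decide) (by decide)
  have i2 := sub0 {3} {2} {2, 3} ∅ (by decide) (by decide)
  have i3 := sub1 {1, 3, 6, 7} {1, 2, 3, 6} {1, 2, 3, 6, 7} {1, 3, 6} (by decide) (by decide)
    (by decide) (by decide) (by decide) (by decide)
  have i4 := sub0 {1, 3, 4, 5, 6} {1, 2, 3, 4, 5} {1, 2, 3, 4, 5, 6} {1, 3, 4, 5} (by decide) (by decide)
  have i5 := sub1 {3, 4, 5, 6, 7} {1, 4, 5, 6, 7} {1, 3, 4, 5, 6, 7} {4, 5, 6, 7} (by decide) (by decide)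
    (by decide) (by decide) (by decide) (by decide)
  have i6 := sub0 {1, 2, 4, 6, 7} {1, 2, 3, 4, 6} {1, 2, 3, 4, 6, 7} {1, 2, 4, 6} (by decide) (by decide)
  have i7 := sub0 {7} {2} {2, 7} ∅ (by decide) (by decide)
  have i8 := sub0 {2, 3, 4, 5, 6, 7} {1, 2, 3, 5, 6, 7} {1, 2, 3, 4, 5, 6, 7} {2, 3, 5, 6, 7} (by decide) (by decide)
  have i9 := sub0 {1, 3} {1, 2} {1, 2, 3} {1} (by decide) (by decide)
  have i10 := sub0 {1, 3, 6} {1, 3, 5} {1, 3, 5, 6} {1, 3} (by decide) (by decide)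
  have i11 := sub1 {2, 3, 5, 6, 7} {1, 2, 3, 6, 7} {1, 2, 3, 5, 6, 7} {2, 3, 6, 7} (by decide) (by decide)
    (by decide) (by decide) (by decide) (by decide)
  have i12 := sub0 {1, 2, 6} {1, 2, 5} {1, 2, 5, 6} {1, 2} (by decide) (by decide)
  have i13 := sub0 {3, 7} {1, 7} {1, 3, 7} {7} (by decide) (by decide)
  have i14 := sub1 {1, 3, 5, 6} {1, 3, 4, 5} {1, 3, 4, 5, 6} {1, 3, 5} (by decide) (by decide)
    (by decide) (by decide) (by decide) (by decide)
  have i15 := sub0 {2, 6, 7} {1, 6, 7} {1, 2, 6, 7} {6, 7} (by decide) (by decide)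
  have i16 := sub0 {2, 3} {1, 2} {1, 2, 3} {2} (by decide) (by decide)
  have i17 := sub0 {1, 6, 7} {1, 3, 7} {1, 3, 6, 7} {1, 7} (by decide) (by decide)
  have i18 := sub0 {1, 3, 4, 5, 6, 7} {1, 2, 4, 5, 6, 7} {1, 2, 3, 4, 5, 6, 7} {1, 4, 5, 6, 7} (by decide) (by decide)
  have i19 := sub0 {7} {3} {3, 7} ∅ (by decide) (by decide)
  have i20 := sub0 {5} {4} {4, 5} ∅ (by decide) (by decide)
  have i21 := sub1 {1, 2, 6, 7} {1, 2, 4, 6} {1, 2, 4, 6, 7} {1, 2, 6} (by decide) (by decide)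
    (by decide) (by decide) (by decide) (by decide)
  have i22 := sub0 {4, 5} {1, 5} {1, 4, 5} {5} (by decide) (by decide)
  have i23 := sub0 {6, 7} {2, 7} {2, 6, 7} {7} (by decide) (by decide)
  have i24 := sub1 {1, 2, 5, 6} {1, 2, 3, 5} {1, 2, 3, 5, 6} {1, 2, 5} (by decide) (by decide)
    (by decide) (by decide) (by decide) (by decide)
  have i25 := sub0 {5} {1} {1, 5} ∅ (by decide) (by decide)
  have i26 := mono {1, 2, 3, 4, 6} {1, 2, 3, 4, 5, 6} (by decide)
  have i27 := mono {1, 2, 4, 5, 6, 7} {1, 2, 3, 4, 5, 6, 7} (by decide)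
  have i28 := mono {2, 3, 4, 6, 7} {1, 2, 3, 4, 6, 7} (by decide)
  have i29 := mono1 {2, 3, 4, 5} {1, 2, 3, 4, 5} (by decide)
    (by decide) (by decide)
  have i30 := mono {1, 2, 3, 6} {1, 2, 3, 5, 6} (by decide)
  have i31 := mono {1, 2, 3, 5} {1, 2, 3, 4, 5} (by decide)
  have i32 := mono1 {2, 3, 6, 7} {2, 3, 4, 6, 7} (by decide)
    (by decide) (by decide)
  have i33 := mono {3, 4, 5, 6, 7} {2, 3, 4, 5, 6, 7} (by decide)
  have i34 := mono {2, 3, 4, 5, 6, 7} {1, 2, 3, 4, 5, 6, 7} (by decide)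
  have m1 := hm 1 (by decide)
  have m2 := hm 2 (by decide)
  have m3 := hm 3 (by decide)
  have m4 := hm 4 (by decide)
  have m5 := hm 5 (by decide)
  have uA := hu {1} (by decide)
  have uAD := hu {1, 6, 7} (by decide)
  have qAB := hq {1, 2, 3} (by decide)
  have qAC := hq {1, 4, 5} (by decide)
  have qABC := hq {1, 2, 3, 4, 5} (by decide)
  rw [show pairA ∪ pairB ∪ pairC = insert 0 {1, 2, 3, 4, 5} by decide,
    show pairA ∪ pairB = insert 0 {1, 2, 3} by decide,
    show pairA ∪ pairC = insert 0 {1, 4, 5} by decide,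
    show pairA ∪ pairD = insert 0 {1, 6, 7} by decide,
    show pairA = insert 0 {1} by decide, uA, uAD, qAB, qAC, qABC,
    show pairD ∪ pairB ∪ pairC = {2, 3, 4, 5, 6, 7} by decide,
    show pairD ∪ pairB = {2, 3, 6, 7} by decide,
    show pairD ∪ pairC = {4, 5, 6, 7} by decide,
    show pairB ∪ pairC = {2, 3, 4, 5} by decide, pairB, pairC, pairD] at zy
  linarith

theorem VamosDep.four_le_card {X : Finset (Fin 8)} (h : VamosDep X) : 4 ≤ X.card := by
  rcases h with rfl | rfl | rfl | rfl | rfl | h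
  iterate 5 decide
  lia

theorem vamosDep_iff (X : Finset (Fin 8)) :
    VamosDep X ↔ 5 ≤ X.card ∨ X.card = 4 ∧ (X = pairA ∪ pairB ∨ X = pairA ∪ pairC ∨
      X = pairB ∪ pairC ∨ X = pairB ∪ pairD ∨ X = pairC ∪ pairD) := by
  refine ⟨fun h => ?_, fun h => by unfold VamosDep; tauto⟩
  rcases h.four_le_card.eq_or_lt with h4 | h5
  · have : ¬ 5 ≤ X.card := by lia
    exact .inr ⟨h4.symm, by unfold VamosDep at h; tauto⟩
  · exact .inl h5

instance (X : Finset (Fin 8)) : Decidable (VamosDep X) :=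
  decidable_of_iff' _ (vamosDep_iff X)

theorem VamosDep.mono {X Y : Finset (Fin 8)} (h : VamosDep X) (hXY : X ⊆ Y) : VamosDep Y := by
  rcases hXY.eq_or_ssubset with rfl | hlt
  · exact h
  · have := Finset.card_lt_card hlt
    have := h.four_le_card
    exact .inr (.inr (.inr (.inr (.inr (by lia)))))

theorem vamosCircuit_iff (X : Finset (Fin 8)) :
    VamosCircuit X ↔ VamosDep X ∧ ∀ i ∈ X, ¬ VamosDep (X.erase i) := by
  refine and_congr_right fun _ => ⟨fun h i hi => h _ (Finset.erase_ssubset hi), fun h Y hY hd => ?_⟩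
  obtain ⟨i, hi, hiY⟩ := Finset.exists_of_ssubset hY
  exact h i hi (hd.mono (Finset.subset_erase.2 ⟨hY.subset, hiY⟩))

instance (X : Finset (Fin 8)) : Decidable (VamosCircuit X) :=
  decidable_of_iff' _ (vamosCircuit_iff X)

instance (x : Fin 8) (Y : Finset (Fin 8)) : Decidable (VamosQualified x Y) :=
  decidable_of_iff (x ∈ Y ∨ ∃ M ∈ Y.powerset, x ∉ M ∧ VamosCircuit (insert x M))
    (by simp [VamosQualified])

theorem vamosQualified_of_mem : ∀ x ∈ pairA, ∀ X ∈ qualifiedSets,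
    VamosQualified x (X.image (Equiv.swap 0 x)) := by
  decide +kernel

theorem not_vamosQualified_of_mem : ∀ x ∈ pairA, ∀ X ∈ unqualifiedSets,
    ¬ VamosQualified x (X.image (Equiv.swap 0 x)) := by
  decide +kernel

/-- The entropy of a function of a random variable with finitely many values is the entropy of
the partition that the function induces on the values. -/
theorem shannonEntropy_comp {Ω : Type} [MeasurableSpace Ω] (μ : Measure Ω) [IsFiniteMeasure μ]
    {T α : Type} [Fintype T] [Fintype α] (J : Ω → T) (hJ : ∀ t, MeasurableSet (J ⁻¹' {t}))
    (g : T → α) :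
    shannonEntropy μ (fun ω => g (J ω)) =
      partEntropy (fun t => (μ (J ⁻¹' {t})).toReal) (Setoid.ker g) := by
  classical
  set p : T → ℝ := fun t => (μ (J ⁻¹' {t})).toReal
  have hmass (a : α) : (μ ((fun ω => g (J ω)) ⁻¹' {a})).toReal = ∑ t with g t = a, p t := by
    have hset : (fun ω => g (J ω)) ⁻¹' {a} = ⋃ t ∈ Finset.univ.filter (g · = a), J ⁻¹' {t} := by
      ext ω
      simp
    rw [hset]
    refine measureReal_biUnion_finset (fun s _ t _ hst => ?_) fun t _ => hJ t
    exact Disjoint.preimage _ (by simpa using hst)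
  have hclass (t : T) : classMass p (Setoid.ker g) t = ∑ s with g s = g t, p s := by
    simp only [classMass, Setoid.ker_def, mul_ite, mul_one, mul_zero, Finset.sum_filter, eq_comm]
  simp only [shannonEntropy, hmass, partEntropy, hclass, Real.negMulLog, neg_mul,
    Finset.sum_neg_distrib, neg_inj]
  rw [← Finset.sum_fiberwise Finset.univ g]
  refine Finset.sum_congr rfl fun a _ => ?_
  rw [Finset.sum_mul]
  refine Finset.sum_congr rfl fun t ht => ?_
  rw [(Finset.mem_filter.1 ht).2]

namespace Scheme

variable {P : Type} [Fintype P] [DecidableEq P] (S : Scheme P)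

/-- The possible joint values of the shares and the secret. -/
abbrev JointT : Type := (∀ p, S.ShT p) × S.SecT

/-- The joint value of the shares and the secret. -/
def joint (ω : S.Ω) : S.JointT := (fun p => S.share p ω, S.secret ω)

noncomputable instance : Fintype S.JointT :=
  letI := S.shFin
  letI := S.secFin
  inferInstance

/-- The joint law of the shares and the secret. -/
noncomputable def law (t : S.JointT) : ℝ :=
  letI := S.mΩ
  (S.μ (S.joint ⁻¹' {t})).toReal

/-- The partition of the joint values according to the share of `p`. -/
def shareSetoid (p : P) : Setoid S.JointT := Setoid.ker fun t => t.1 p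

/-- The partition of the joint values according to the secret. -/
def secretSetoid : Setoid S.JointT := Setoid.ker Prod.snd

theorem law_nonneg (t : S.JointT) : 0 ≤ S.law t := ENNReal.toReal_nonneg

theorem measurableSet_joint_preimage (t : S.JointT) :
    letI := S.mΩ
    MeasurableSet (S.joint ⁻¹' {t}) := by
  let := S.mΩ
  have h : S.joint ⁻¹' {t} = (⋂ p, S.share p ⁻¹' {t.1 p}) ∩ S.secret ⁻¹' {t.2} := by
    ext ω
    simp [joint, Prod.ext_iff, funext_iff]
  rw [h]
  exact (MeasurableSet.iInter fun p => S.share_meas p _).inter (S.secret_meas _)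

theorem shannonEntropy_joint {α : Type} [Fintype α] (g : S.JointT → α) :
    letI := S.mΩ
    shannonEntropy S.μ (fun ω => g (S.joint ω)) = partEntropy S.law (Setoid.ker g) :=
  let := S.mΩ
  let := S.prob
  shannonEntropy_comp S.μ S.joint S.measurableSet_joint_preimage g

theorem sum_law : ∑ t, S.law t = 1 := by
  let := S.mΩ
  let := S.prob
  have h : ∑ t, S.law t = S.μ.real (⋃ t ∈ (Finset.univ : Finset S.JointT), S.joint ⁻¹' {t}) :=
    (measureReal_biUnion_finset
      (fun s _ t _ hst => Disjoint.preimage _ (by simpa using hst))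
      fun t _ => S.measurableSet_joint_preimage t).symm
  have hu : (⋃ t ∈ (Finset.univ : Finset S.JointT), S.joint ⁻¹' {t}) = Set.univ := by
    ext ω
    simp
  rw [h, hu, probReal_univ]

theorem ker_restrict (X : Finset P) :
    Setoid.ker (fun (t : S.JointT) (p : {y // y ∈ X}) => t.1 p.1) = X.inf S.shareSetoid := by
  ext s t
  have h : (X.inf S.shareSetoid) s t ↔ ∀ p ∈ X, s.1 p = t.1 p := by
    induction X using Finset.induction_on with
    | empty => exact iff_of_true trivial (by simp)
    | insert a X _ ih =>
      rw [Finset.inf_insert, Setoid.inf_iff_and, ih, Finset.forall_mem_insert]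
      rfl
  rw [h, Setoid.ker_def, funext_iff, Subtype.forall]

theorem Hset_eq (X : Finset P) : S.Hset X = partEntropy S.law (X.inf S.shareSetoid) := by
  let := S.shFin
  rw [← S.ker_restrict]
  exact S.shannonEntropy_joint fun t (p : {y // y ∈ X}) => t.1 p.1

theorem HsetS_eq (X : Finset P) :
    S.HsetS X = partEntropy S.law (X.inf S.shareSetoid ⊓ S.secretSetoid) := by
  let := S.shFin
  let := S.secFin
  have h : X.inf S.shareSetoid ⊓ S.secretSetoid =
      Setoid.ker fun t : S.JointT => ((fun p : {y // y ∈ X} => t.1 p.1), t.2) := by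
    rw [← S.ker_restrict]
    ext s t
    rw [Setoid.inf_iff_and, Setoid.ker_def, Setoid.ker_def, Prod.ext_iff]
    rfl
  rw [h]
  exact S.shannonEntropy_joint fun t => ((fun p : {y // y ∈ X} => t.1 p.1), t.2)

end Scheme

/-- If the dealer is a member of the Vamos pair `A`, then some participant has a share of
normalized entropy at least `9/8`. -/
theorem nine_eighths_le_of_isPerfect (x : Fin 8) (hx : x ∈ pairA) (S : Scheme (Fin 8))
    (hperf : S.IsPerfect (VamosQualified x)) (hpos : 0 < S.Hsec) (m : ℝ)
    (hm : ∀ i, S.hset {i} ≤ m) : 9 / 8 ≤ m := by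
  set σ : Fin 8 → Fin 8 := ⇑(Equiv.swap 0 x)
  set ρ : Fin 8 → Setoid S.JointT := fun i => if i = 0 then S.secretSetoid else S.shareSetoid (σ i)
  have hp := S.law_nonneg
  have inf_ρ (X : Finset (Fin 8)) (h0 : 0 ∉ X) : X.inf ρ = (X.image σ).inf S.shareSetoid := by
    rw [Finset.inf_image]
    exact Finset.inf_congr rfl fun i hi => if_neg (ne_of_mem_of_not_mem hi h0)
  have inf_insert_ρ (X : Finset (Fin 8)) (h0 : 0 ∉ X) :
      (insert 0 X).inf ρ = (X.image σ).inf S.shareSetoid ⊓ S.secretSetoid := by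
    rw [Finset.inf_insert, inf_ρ X h0, inf_comm]
    rfl
  refine nine_eighths_le_of_polymatroid (fun X => partEntropy S.law (X.inf ρ) / S.Hsec) m
    ?_ ?_ ?_ ?_ ?_ ?_ ?_
  · simp [partEntropy_top S.sum_law]
  · exact fun X Y h => div_le_div_of_nonneg_right
      (partEntropy_anti hp (Finset.inf_mono h)) hpos.le
  · intro X Y
    rw [← add_div, ← add_div, Finset.inf_union]
    exact div_le_div_of_nonneg_right (partEntropy_submodular hp
      (Finset.inf_mono Finset.inter_subset_left) (Finset.inf_mono Finset.inter_subset_right))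
      hpos.le
  · have h := div_le_div_of_nonneg_right
      (zhang_yeung hp (pairA.inf ρ) (pairD.inf ρ) (pairB.inf ρ) (pairC.inf ρ)) hpos.le
    simp only [Finset.inf_union]
    refine le_trans (le_of_eq ?_) (h.trans (le_of_eq ?_)) <;> ring
  · intro X hX
    have h0 : 0 ∉ X := by
      revert X
      decide +kernel
    have h := hperf.1 _ (vamosQualified_of_mem x hx X hX)
    rw [S.Hset_eq, S.HsetS_eq] at h
    simp only [inf_insert_ρ X h0, inf_ρ X h0]
    rw [sub_eq_zero.1 h]
  · intro X hX
    have h0 : 0 ∉ X := by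
      revert X
      decide +kernel
    have h := hperf.2 _ (not_vamosQualified_of_mem x hx X hX)
    rw [S.Hset_eq, S.HsetS_eq] at h
    simp only [inf_insert_ρ X h0, inf_ρ X h0]
    rw [sub_eq_iff_eq_add'.1 h, add_div, div_self hpos.ne']
  · intro i hi
    have h := hm (σ i)
    rw [Scheme.hset, S.Hset_eq] at h
    simpa [inf_ρ {i} (by simpa using hi.symm)] using h

/-- If the dealer is a member of the Vamos pair `A`, then `2/19 ≤ λ`. -/
theorem dealer_in_A_lam (x : Fin 8) (hx : x ∈ pairA)
    (S : Scheme (Fin 8)) (hperf : S.IsPerfect (VamosQualified x)) (hpos : 0 < S.Hsec) :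
    2 / 19 ≤ S.lam := by
  have h := nine_eighths_le_of_isPerfect x hx S hperf hpos (S.lam + 1) fun i => by
    rw [Scheme.lam, sub_add_cancel]
    exact Finset.le_sup' (fun i : Fin 8 => S.hset {i}) (Finset.mem_univ i)
  linarith
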